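/- arXiv:2302.05620 — 2 statements merged into one kernel-verified Lean document; each statement's English description precedes it below -/
import Mathlib

section
/- Suppose K is β_K-strongly convex. Let f, g : ℝ^d → ℝ be differentiable functions such that f is convex on K and α-smooth on K. Let x⋆ ∈ K be a minimizer of f over K and y⋆ ∈ K a minimizer of g over K. Let x ∈ K, let v ∈ K be a linear-optimization step at x for f, let σ_t ∈ [0,1] be a line-search step size at (x, v) for f, and set x' = (1−σ_t)x + σ_t v. Let δ be a real number with |g(u) − f(u)| ≤ δ for all u ∈ K, and set C = max{1 − β_K‖∇f(x)‖/(8α), 1/2}. Then g(x') − g(y⋆) ≤ δ + C·(f(x) − f(x⋆)) + f(x⋆) − g(y⋆). -/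
open RealInnerProductSpace

/-- First-order lower bound for a convex function that is differentiable at a point of its
domain of convexity. -/
theorem ConvexOn.add_inner_gradient_le {E : Type*} [NormedAddCommGroup E] [InnerProductSpace ℝ E]
    [CompleteSpace E] {s : Set E} {f : E → ℝ} (hf : ConvexOn ℝ s f) {x y : E}
    (hx : x ∈ s) (hy : y ∈ s) (hd : DifferentiableAt ℝ f x) :
    f x + ⟪gradient f x, y - x⟫ ≤ f y := by
  have hg : HasFDerivAt f (InnerProductSpace.toDual ℝ E (gradient f x)) x :=
    hd.hasGradientAt.hasFDerivAt
  have hline : HasDerivAt (f ∘ AffineMap.lineMap (k := ℝ) x y) ⟪gradient f x, y - x⟫ 0 := by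
    have h := hg.comp_hasDerivAt_of_eq (0 : ℝ)
      (AffineMap.hasDerivAt_lineMap (a := x) (b := y)) (by simp)
    simpa using h
  have hslope := (hf.comp_affineMap (AffineMap.lineMap (k := ℝ) x y)).le_slope_of_hasDerivAt
    (x := 0) (y := 1) (by simpa using hx) (by simpa using hy) one_pos hline
  simp only [slope_def_field, Function.comp_apply, AffineMap.lineMap_apply_zero,
    AffineMap.lineMap_apply_one, sub_zero, div_one] at hslope
  linarith

/-- Over a strongly convex set, the linear gap at a linear minimizer dominates the squared
distance to it, scaled by the norm of the linear functional. -/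
theorem norm_mul_sq_le_inner_sub_of_strongly_convex {E : Type*} [NormedAddCommGroup E]
    [InnerProductSpace ℝ E] {K : Set E} {β : ℝ}
    (hK : ∀ x ∈ K, ∀ y ∈ K, ∀ γ ∈ Set.Icc (0 : ℝ) 1, ∀ z : E, ‖z‖ = 1 →
      γ • x + (1 - γ) • y + (γ * (1 - γ) * (β / 2) * ‖x - y‖ ^ 2) • z ∈ K)
    {c x v : E} (hx : x ∈ K) (hv : v ∈ K) (hmin : ∀ u ∈ K, ⟪c, v⟫ ≤ ⟪c, u⟫) :
    β / 4 * ‖c‖ * ‖x - v‖ ^ 2 ≤ ⟪c, x - v⟫ := by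
  rw [inner_sub_right]
  rcases eq_or_ne c 0 with rfl | hc
  · simp
  have hn : ‖c‖ ≠ 0 := norm_ne_zero_iff.mpr hc
  have hz : ‖(-‖c‖⁻¹) • c‖ = 1 := by
    rw [norm_smul, norm_neg, norm_inv, norm_norm, inv_mul_cancel₀ hn]
  have h := hmin _ (hK x hx v hv (1 / 2) (by norm_num) _ hz)
  have hcz : ⟪c, (-‖c‖⁻¹) • c⟫ = -‖c‖ := by
    rw [real_inner_smul_right, real_inner_self_eq_norm_sq]
    field_simp
  rw [inner_add_right, inner_add_right, real_inner_smul_right, real_inner_smul_right,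
    real_inner_smul_right, hcz] at h
  linarith

/-- Lemma 4: one OFW step with line search over a strongly convex set. -/
theorem ofw_one_step_line_search_strongly_convex_set
    {d : ℕ} {K : Set (EuclideanSpace ℝ (Fin d))}
    (hKne : K.Nonempty) (hKconv : Convex ℝ K)
    {D : ℝ} (hD : 0 < D) (hdiam : ∀ x ∈ K, ∀ y ∈ K, ‖x - y‖ ≤ D)
    {βK : ℝ} (hβK : 0 < βK)
    (hKsc : ∀ x ∈ K, ∀ y ∈ K, ∀ γ ∈ Set.Icc (0 : ℝ) 1,
      ∀ z : EuclideanSpace ℝ (Fin d), ‖z‖ = 1 →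
        γ • x + (1 - γ) • y + (γ * (1 - γ) * (βK / 2) * ‖x - y‖ ^ 2) • z ∈ K)
    {α : ℝ} (hα : 0 < α)
    {f g : EuclideanSpace ℝ (Fin d) → ℝ}
    (hfdiff : Differentiable ℝ f) (hgdiff : Differentiable ℝ g)
    (hfconv : ConvexOn ℝ K f)
    (hfsmooth : ∀ x ∈ K, ∀ y ∈ K,
      f y ≤ f x + ⟪gradient f x, y - x⟫ + α / 2 * ‖x - y‖ ^ 2)
    {xstar ystar : EuclideanSpace ℝ (Fin d)}
    (hxstarK : xstar ∈ K) (hxstar : ∀ u ∈ K, f xstar ≤ f u)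
    (hystarK : ystar ∈ K) (hystar : ∀ u ∈ K, g ystar ≤ g u)
    {x v : EuclideanSpace ℝ (Fin d)} (hxK : x ∈ K) (hvK : v ∈ K)
    (hv : ∀ u ∈ K, ⟪gradient f x, v⟫ ≤ ⟪gradient f x, u⟫)
    {σt : ℝ} (hσt : σt ∈ Set.Icc (0 : ℝ) 1)
    (hls : ∀ σ' ∈ Set.Icc (0 : ℝ) 1,
      σt * ⟪gradient f x, v - x⟫ + α * σt ^ 2 / 2 * ‖x - v‖ ^ 2 ≤
        σ' * ⟪gradient f x, v - x⟫ + α * σ' ^ 2 / 2 * ‖x - v‖ ^ 2)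
    {x' : EuclideanSpace ℝ (Fin d)} (hx' : x' = (1 - σt) • x + σt • v)
    {δ : ℝ} (hδ : ∀ u ∈ K, |g u - f u| ≤ δ)
    {C : ℝ} (hC : C = max (1 - βK * ‖gradient f x‖ / (8 * α)) (1 / 2)) :
    g x' - g ystar ≤ δ + C * (f x - f xstar) + f xstar - g ystar := by
  have hx'K : x' ∈ K := by
    rw [hx']
    exact hKconv hxK hvK (by linarith [hσt.2]) hσt.1 (by ring)
  have hgap := norm_mul_sq_le_inner_sub_of_strongly_convex hKsc hxK hvK hv
  have hfirst := hfconv.add_inner_gradient_le hxK hxstarK (hfdiff x)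
  have hvstar := hv xstar hxstarK
  have hsmooth := hfsmooth x hxK x' hx'K
  have hdir : x' - x = σt • (v - x) := by rw [hx']; module
  have hdist : ‖x - x'‖ ^ 2 = σt ^ 2 * ‖x - v‖ ^ 2 := by
    rw [norm_sub_rev, hdir, norm_smul, mul_pow, Real.norm_eq_abs, sq_abs, norm_sub_rev]
  rw [hdist, hdir, real_inner_smul_right] at hsmooth
  set G := ‖gradient f x‖
  set R := ‖x - v‖ ^ 2
  have hR : 0 ≤ R := sq_nonneg _
  have hG : 0 ≤ G := norm_nonneg _
  simp only [inner_sub_right] at hgap hfirst hsmooth hls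
  set p := ⟪gradient f x, x⟫ - ⟪gradient f x, v⟫ with hp
  have hhp : f x - f xstar ≤ p := by linarith
  set σ := min 1 (βK * G / (4 * α)) with hσ
  have hσ0 : 0 ≤ σ := le_min zero_le_one (by positivity)
  have hσ1 : σ ≤ 1 := min_le_left _ _
  have hCσ : C = 1 - σ / 2 := by
    have hhalf : βK * G / (8 * α) = βK * G / (4 * α) / 2 := by ring
    rw [hC, hσ, hhalf]
    rcases le_total 1 (βK * G / (4 * α)) with h | h
    · rw [min_eq_left h, max_eq_right (by linarith)]; norm_num
    · rw [min_eq_right h, max_eq_left (by linarith)]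
  have hασ : α * σ ≤ βK / 4 * G := by
    calc α * σ ≤ α * (βK * G / (4 * α)) := by gcongr; exact min_le_right _ _
      _ = βK / 4 * G := by field_simp
  have hcurv : α * σ * R ≤ p := (mul_le_mul_of_nonneg_right hασ hR).trans hgap
  have hstep := hls σ ⟨hσ0, hσ1⟩
  have hquad : σ * (α * σ * R) ≤ σ * p := mul_le_mul_of_nonneg_left hcurv hσ0
  have hlin : σ * (f x - f xstar) ≤ σ * p := mul_le_mul_of_nonneg_left hhp hσ0
  have hdecr : f x' ≤ f x - σ / 2 * (f x - f xstar) := by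
    rw [hp] at hquad hlin
    linarith
  have hclose := (abs_le.mp (hδ x' hx'K)).2
  rw [hCσ]
  linarith
end

section
/- Let f : ℝ^d → ℝ be differentiable, convex on K and α-smooth on K, and let x⋆ ∈ K be a minimizer of f over K. Let x ∈ K and let x' ∈ K be a Euclidean projection onto K of x − (1/α)∇f(x), i.e., ‖x' − (x − (1/α)∇f(x))‖ ≤ ‖u − (x − (1/α)∇f(x))‖ for all u ∈ K. Then f(x') − f(x⋆) ≤ f(x) − f(x⋆) − (f(x') − f(x⋆))²/(2αD²). -/
open RealInnerProductSpace

section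

variable {F : Type*} [NormedAddCommGroup F] [InnerProductSpace ℝ F]

/-- First-order characterization of convexity: the tangent at `x` lies below `f` on `K`. -/
theorem ConvexOn.add_inner_gradient_le_s17 [CompleteSpace F] {K : Set F} {f : F → ℝ}
    (hf : ConvexOn ℝ K f) {x u : F} (hdiff : DifferentiableAt ℝ f x) (hx : x ∈ K) (hu : u ∈ K) :
    f x + ⟪gradient f x, u - x⟫ ≤ f u := by
  have hline : HasDerivAt (f ∘ AffineMap.lineMap (k := ℝ) x u) ⟪gradient f x, u - x⟫ 0 := by
    have hfx : HasFDerivAt f (InnerProductSpace.toDual ℝ F (gradient f x))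
        (AffineMap.lineMap (k := ℝ) x u 0) := by
      simpa using hdiff.hasGradientAt.hasFDerivAt
    simpa using hfx.comp_hasDerivAt (0 : ℝ) AffineMap.hasDerivAt_lineMap
  have hslope := (hf.comp_affineMap (AffineMap.lineMap (k := ℝ) x u)).le_slope_of_hasDerivAt
    (by simpa using hx) (by simpa using hu) zero_lt_one hline
  simp only [slope_def_field, Function.comp_apply, AffineMap.lineMap_apply_zero,
    AffineMap.lineMap_apply_one, sub_zero, div_one] at hslope
  linarith

/-- Variational inequality for a nearest point `v` of a convex set. -/
theorem Convex.inner_le_zero_of_forall_norm_sub_le {K : Set F} (hK : Convex ℝ K) {v z : F}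
    (hv : v ∈ K) (hmin : ∀ u ∈ K, ‖v - z‖ ≤ ‖u - z‖) {u : F} (hu : u ∈ K) :
    ⟪z - v, u - v⟫ ≤ 0 := by
  refine (norm_eq_iInf_iff_real_inner_le_zero hK hv).1 (le_antisymm ?_ ?_) u hu
  · have : Nonempty K := ⟨⟨v, hv⟩⟩
    refine le_ciInf fun w => ?_
    simpa only [norm_sub_rev] using hmin w w.2
  · exact ciInf_le (f := fun w : K => ‖z - w‖)
      ⟨0, Set.forall_mem_range.2 fun _ => norm_nonneg _⟩ ⟨v, hv⟩

/-- Progress of one projected gradient step relative to any comparator `u ∈ K`. -/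
theorem ConvexOn.projected_gradient_step_le [CompleteSpace F] {K : Set F} {f : F → ℝ}
    (hf : ConvexOn ℝ K f) {α : ℝ} (hα : 0 < α) {x x' u : F} (hdiff : DifferentiableAt ℝ f x)
    (hsmooth : f x' ≤ f x + ⟪gradient f x, x' - x⟫ + α / 2 * ‖x - x'‖ ^ 2)
    (hx : x ∈ K) (hx' : x' ∈ K) (hu : u ∈ K)
    (hproj : ∀ y ∈ K,
      ‖x' - (x - (1 / α) • gradient f x)‖ ≤ ‖y - (x - (1 / α) • gradient f x)‖) :
    f x' ≤ f u + α * ⟪x - x', x - u⟫ - α / 2 * ‖x - x'‖ ^ 2 := by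
  have htangent := hf.add_inner_gradient_le_s17 hdiff hx hu
  have hvar : α * ⟪x - x', u - x'⟫ ≤ ⟪gradient f x, u - x'⟫ := by
    have h := hf.1.inner_le_zero_of_forall_norm_sub_le hx' hproj hu
    rw [sub_right_comm, inner_sub_left, real_inner_smul_left, sub_nonpos, one_div,
      ← div_eq_inv_mul, le_div_iff₀ hα] at h
    linarith
  have hgrad : ⟪gradient f x, u - x'⟫ = ⟪gradient f x, u - x⟫ - ⟪gradient f x, x' - x⟫ := by
    rw [← inner_sub_right, sub_sub_sub_cancel_right]
  have hstep : ⟪x - x', u - x'⟫ = ‖x - x'‖ ^ 2 - ⟪x - x', x - u⟫ := by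
    rw [← real_inner_self_eq_norm_sq, ← inner_sub_right]
    congr 1
    abel
  rw [hstep] at hvar
  linarith

end

/-- one projected-gradient step with step size 1/α. -/
theorem ogd_one_step_bound
    {d : ℕ} {K : Set (EuclideanSpace ℝ (Fin d))}
    (hKne : K.Nonempty) (hKclosed : IsClosed K) (hKconv : Convex ℝ K)
    {D : ℝ} (hD : 0 < D) (hdiam : ∀ x ∈ K, ∀ y ∈ K, ‖x - y‖ ≤ D)
    {α : ℝ} (hα : 0 < α)
    {f : EuclideanSpace ℝ (Fin d) → ℝ}
    (hfdiff : Differentiable ℝ f)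
    (hfconv : ConvexOn ℝ K f)
    (hfsmooth : ∀ x ∈ K, ∀ y ∈ K,
      f y ≤ f x + ⟪gradient f x, y - x⟫ + α / 2 * ‖x - y‖ ^ 2)
    {xstar : EuclideanSpace ℝ (Fin d)}
    (hxstarK : xstar ∈ K) (hxstar : ∀ u ∈ K, f xstar ≤ f u)
    {x x' : EuclideanSpace ℝ (Fin d)} (hxK : x ∈ K) (hx'K : x' ∈ K)
    (hproj : ∀ u ∈ K,
      ‖x' - (x - (1 / α) • gradient f x)‖ ≤ ‖u - (x - (1 / α) • gradient f x)‖) :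
    f x' - f xstar ≤ f x - f xstar - (f x' - f xstar) ^ 2 / (2 * α * D ^ 2) := by
  have hdescent := hfconv.projected_gradient_step_le hα (hfdiff x) (hfsmooth x hxK x' hx'K)
    hxK hx'K hxK hproj
  have hgap := hfconv.projected_gradient_step_le hα (hfdiff x) (hfsmooth x hxK x' hx'K)
    hxK hx'K hxstarK hproj
  rw [sub_self, inner_zero_right] at hdescent
  have hinner : ⟪x - x', x - xstar⟫ ≤ ‖x - x'‖ * D :=
    (real_inner_le_norm _ _).trans (by gcongr; exact hdiam x hxK xstar hxstarK)
  have hbound : f x' - f xstar ≤ α * (‖x - x'‖ * D) := by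
    have := mul_le_mul_of_nonneg_left hinner hα.le
    have : 0 ≤ α / 2 * ‖x - x'‖ ^ 2 := by positivity
    linarith
  have hsq : (f x' - f xstar) ^ 2 / (2 * α * D ^ 2) ≤ α / 2 * ‖x - x'‖ ^ 2 := by
    rw [div_le_iff₀ (by positivity)]
    calc (f x' - f xstar) ^ 2 ≤ (α * (‖x - x'‖ * D)) ^ 2 :=
          pow_le_pow_left₀ (sub_nonneg.2 (hxstar x' hx'K)) hbound 2
      _ = α / 2 * ‖x - x'‖ ^ 2 * (2 * α * D ^ 2) := by ring
  linarith
end
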